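/- arXiv:2207.08007 — 2 statements merged into one kernel-verified Lean document; each statement's English description precedes it below -/
import Mathlib

section
/- Let k ≥ 2 and let D be a super-orientation of the complement of C_{2k+1}, with vertices labeled x_0,…,x_{2k} so that x_i and x_j are adjacent in the underlying graph if and only if j − i ≢ ±1 (mod 2k+1). If D has no path partition orthogonal to {x_0, x_{2k}}, then D is isomorphic (as a digraph) to D⃗_{2k+1}. -/
/-- A directed path in a digraph with arc relation `A`: a nonempty list of distinct
vertices each of which dominates the next. -/
def IsDipath {V : Type*} (A : V → V → Prop) (p : List V) : Prop :=
  p ≠ [] ∧ p.Nodup ∧ p.Chain' A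

/-- A path partition of the digraph `(V, A)`: a collection of vertex-disjoint directed
paths covering all of `V`. -/
def IsPathPartition {V : Type*} (A : V → V → Prop) (P : Set (List V)) : Prop :=
  (∀ p ∈ P, IsDipath A p) ∧
  (∀ p ∈ P, ∀ q ∈ P, p ≠ q → ∀ v : V, v ∈ p → v ∉ q) ∧
  (∀ v : V, ∃ p ∈ P, v ∈ p)

/-- A path partition `P` and a stable set `S` are orthogonal if every path of `P`
contains exactly one vertex of `S`. -/
def OrthogonalPP {V : Type*} (P : Set (List V)) (S : Set V) : Prop :=
  ∀ p ∈ P, ∃! v : V, v ∈ S ∧ v ∈ p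

/-- The arc relation of the digraph `D⃗_{2k+1}` on vertices `x_0, …, x_{2k}`
(realized as `ZMod (2*k+1)`): the arcs are exactly the pairs `(x_i, x_j)` with
`0 ≤ i < j ≤ 2k`, `j - i ≥ 2` and `(i, j) ≠ (0, 2k)`. -/
def DvecArc (k : ℕ) (u v : ZMod (2*k+1)) : Prop :=
  u.val + 2 ≤ v.val ∧ ¬(u.val = 0 ∧ v.val = 2*k)

section PathLemmas
variable {V : Type*}

theorem aux_ins_head {A : V → V → Prop} {v x : V} (hvx : A v x) (t : List V) :
    ∀ (s : List V) (a : V), (a :: (s ++ x :: t)).IsChain A → A a v →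
      (∀ y ∈ s, A v y ∨ A y v) →
      ∃ p, (a :: p).IsChain A ∧ p.Perm (v :: (s ++ x :: t)) := by
  intro s
  induction s with
  | nil =>
    intro a hc ha _
    refine ⟨v :: x :: t, ?_, List.Perm.refl _⟩
    simp only [List.nil_append, List.isChain_cons_cons] at hc ⊢
    exact ⟨ha, hvx, hc.2⟩
  | cons b s ih =>
    intro a hc ha hs
    simp only [List.cons_append, List.isChain_cons_cons] at hc
    by_cases hb : A v b
    · refine ⟨v :: b :: (s ++ x :: t), ?_, List.Perm.refl _⟩
      simp only [List.isChain_cons_cons]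
      exact ⟨ha, hb, hc.2⟩
    · have hb' : A b v := (hs b (by simp)).resolve_left hb
      obtain ⟨p, hp, hpp⟩ := ih b hc.2 hb' (fun y hy => hs y (by simp [hy]))
      refine ⟨b :: p, ?_, ?_⟩
      · simp only [List.isChain_cons_cons]
        exact ⟨hc.1, hp⟩
      · exact (List.Perm.cons b hpp).trans (List.Perm.swap _ _ _)

theorem aux_ins {A : V → V → Prop} {v x : V} (hvx : A v x) (s t : List V)
    (hc : (s ++ x :: t).IsChain A) (hs : ∀ y ∈ s, A v y ∨ A y v) :
    ∃ p : List V, p.IsChain A ∧ p.Perm (v :: (s ++ x :: t)) := by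
  cases s with
  | nil =>
    refine ⟨v :: x :: t, ?_, List.Perm.refl _⟩
    simp only [List.nil_append, List.isChain_cons_cons] at hc ⊢
    exact ⟨hvx, hc⟩
  | cons b s =>
    by_cases hb : A v b
    · refine ⟨v :: b :: (s ++ x :: t), ?_, List.Perm.refl _⟩
      simp only [List.isChain_cons_cons]
      exact ⟨hb, hc⟩
    · have hb' : A b v := (hs b (by simp)).resolve_left hb
      obtain ⟨p, hp, hpp⟩ := aux_ins_head hvx t s b hc hb' (fun y hy => hs y (by simp [hy]))
      exact ⟨b :: p, hp, (List.Perm.cons b hpp).trans (List.Perm.swap _ _ _)⟩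

theorem aux_ins_rev {A : V → V → Prop} {v x : V} (hvx : A x v) (s t : List V)
    (hc : (s ++ x :: t).IsChain A) (hs : ∀ y ∈ t, A v y ∨ A y v) :
    ∃ p : List V, p.IsChain A ∧ p.Perm (v :: (s ++ x :: t)) := by
  have h1 : (t.reverse ++ x :: s.reverse).IsChain (fun a b => A b a) := by
    have := List.isChain_reverse (R := fun a b => A b a) (l := s ++ x :: t)
    have h2 := this.2 hc
    simpa using h2
  obtain ⟨p, hp, hpp⟩ := aux_ins (A := fun a b => A b a) hvx t.reverse s.reverse h1
    (fun y hy => (hs y (by simpa using hy)).symm)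
  refine ⟨p.reverse, List.isChain_reverse.2 hp, ?_⟩
  refine (List.reverse_perm p).trans (hpp.trans (List.Perm.cons v ?_))
  have := List.reverse_perm (s ++ x :: t)
  simpa using this

theorem aux_mid {A : V → V → Prop} {u : V} {a c : List V} (ha : a.IsChain A) (hc : c.IsChain A)
    (h1 : ∀ x ∈ a, A x u) (h2 : ∀ y ∈ c, A u y) : (a ++ u :: c).IsChain A := by
  rw [List.isChain_append]
  refine ⟨ha, ?_, ?_⟩
  · cases c with
    | nil => simp
    | cons b c => 
      rw [List.isChain_cons_cons]
      exact ⟨h2 b (by simp), hc⟩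
  · intro x hx y hy
    simp only [List.head?_cons, Option.mem_def, Option.some.injEq] at hy
    subst hy
    exact h1 x (List.mem_of_getLast? hx)

/-- a semicomplete digraph has a Hamiltonian path -/
theorem aux_ham [DecidableEq V] {A : V → V → Prop} (S : Finset V) 
    (hS : ∀ x ∈ S, ∀ y ∈ S, x ≠ y → A x y ∨ A y x) :
    ∃ p : List V, p.IsChain A ∧ p.Nodup ∧ ∀ x, x ∈ p ↔ x ∈ S := by
  induction S using Finset.induction_on with
  | empty => exact ⟨[], by simp, by simp, by simp⟩
  | insert v S hv ih =>
    obtain ⟨p, hp, hn, hm⟩ := ih (fun x hx y hy => hS x (by simp [hx]) y (by simp [hy]))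
    have key : ∃ q : List V, q.IsChain A ∧ q.Perm (v :: p) := by
      have hadj : ∀ y ∈ p, A v y ∨ A y v := fun y hy =>
        hS v (by simp) y (by simp [(hm y).1 hy]) (by rintro rfl; exact hv ((hm _).1 hy))
      by_cases hx : ∃ x ∈ p, A v x
      · obtain ⟨x, hx, hvx⟩ := hx
        obtain ⟨s, t, rfl⟩ := List.append_of_mem hx
        exact aux_ins hvx s t hp (fun y hy => hadj y (by simp [hy]))
      · push Not at hx
        refine ⟨p ++ v :: [], aux_mid hp (by simp) (fun x h => (hadj x h).resolve_left (hx x h))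
          (by simp), ?_⟩
        simpa using List.perm_append_comm (l₁ := p) (l₂ := [v])
    obtain ⟨q, hq, hqp⟩ := key
    refine ⟨q, hq, ?_, ?_⟩
    · rw [hqp.nodup_iff, List.nodup_cons]
      exact ⟨fun h => hv ((hm v).1 h), hn⟩
    · intro x
      rw [hqp.mem_iff]
      simp [hm]

theorem aux_split1 {A : V → V → Prop} {u v : V} {a c : List V} (hc : (a ++ u :: c).IsChain A)
    (hadj : ∀ x, x ∈ a ∨ x ∈ c → A v x ∨ A x v)
    (hno : ¬ ∃ p : List V, p.IsChain A ∧ p.Perm (u :: v :: (a ++ c))) :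
    (∀ x ∈ a, ¬ A v x) ∧ (∀ x ∈ c, ¬ A x v) := by
  have hperm : (v :: (a ++ u :: c)).Perm (u :: v :: (a ++ c)) :=
    (List.Perm.cons v List.perm_middle).trans (List.Perm.swap _ _ _)
  constructor
  · intro x hx hvx
    obtain ⟨s, t, rfl⟩ := List.append_of_mem hx
    obtain ⟨p, hp, hpp⟩ := aux_ins (A := A) hvx s (t ++ u :: c) (by simpa using hc)
      (fun y hy => hadj y (by simp [hy]))
    exact hno ⟨p, hp, hpp.trans (by simpa using hperm)⟩
  · intro x hx hvx
    obtain ⟨s, t, rfl⟩ := List.append_of_mem hx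
    obtain ⟨p, hp, hpp⟩ := aux_ins_rev (A := A) hvx (a ++ u :: s) t (by simpa using hc)
      (fun y hy => hadj y (by simp [hy]))
    exact hno ⟨p, hp, hpp.trans (by simpa using hperm)⟩

theorem aux_split [DecidableEq V] {A : V → V → Prop} (S : Finset V) (u v : V) (hu : u ∉ S)
    (hv : v ∉ S) (huv : u ≠ v)
    (hS : ∀ x ∈ S, ∀ y ∈ S, x ≠ y → A x y ∨ A y x)
    (hSu : ∀ x ∈ S, A u x ∨ A x u) (hSv : ∀ x ∈ S, A v x ∨ A x v)
    (hno : ¬ ∃ p : List V, p.IsChain A ∧ p.Nodup ∧ ∀ x, x ∈ p ↔ (x = u ∨ x = v ∨ x ∈ S)) :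
    ∃ L : V → Prop, (∀ x ∈ S, L x → ¬ A u x ∧ ¬ A v x) ∧ (∀ x ∈ S, ¬ L x → ¬ A x u ∧ ¬ A x v) ∧
      ∀ x ∈ S, ∀ y ∈ S, L x → ¬ L y → ¬ A y x := by
  obtain ⟨p, hp, hn, hm⟩ := aux_ham (A := A) (insert u S) (by
    intro x hx y hy hxy
    rw [Finset.mem_insert] at hx hy
    rcases hx with rfl | hx <;> rcases hy with rfl | hy
    · exact absurd rfl hxy
    · exact hSu y hy
    · exact (hSu x hx).symm
    · exact hS x hx y hy hxy)
  obtain ⟨a, c, rfl⟩ := List.append_of_mem ((hm u).2 (by simp))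
  have hn' : u ∉ a ++ c ∧ (a ++ c).Nodup := by
    rw [List.perm_middle.nodup_iff, List.nodup_cons] at hn
    exact hn
  have hm' : ∀ x, x ∈ a ++ c ↔ x ∈ S := by
    intro x
    have h1 := hm x
    rw [List.perm_middle.mem_iff, List.mem_cons, Finset.mem_insert] at h1
    by_cases hx : x = u
    · subst hx; exact iff_of_false hn'.1 hu
    · simpa [hx] using h1
  have hno' : ¬ ∃ p : List V, p.IsChain A ∧ p.Perm (u :: v :: (a ++ c)) := by
    rintro ⟨p, hp, hpp⟩
    refine hno ⟨p, hp, ?_, ?_⟩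
    · rw [hpp.nodup_iff, List.nodup_cons, List.nodup_cons, List.mem_cons]
      exact ⟨by rw [not_or]; exact ⟨huv, hn'.1⟩, fun hh => hv ((hm' v).1 hh), hn'.2⟩
    · intro x
      rw [hpp.mem_iff, List.mem_cons, List.mem_cons, hm']
  have hno'' : ¬ ∃ p : List V, p.IsChain A ∧ p.Perm (v :: u :: (a ++ c)) := by
    rintro ⟨p, hp, hpp⟩
    exact hno' ⟨p, hp, hpp.trans (List.Perm.swap _ _ _)⟩
  have hm'' : ∀ x, x ∈ a ∨ x ∈ c → x ∈ S := fun x hx => (hm' x).1 (by simpa using hx)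
  obtain ⟨h1, h2⟩ := aux_split1 (A := A) (v := v) hp (fun x hx => hSv x (hm'' x hx)) hno'
  have hac := List.isChain_append.1 hp
  have hcc : c.IsChain A := hac.2.1.tail
  have h1' : ∀ x ∈ a, A x v := fun x hx => (hSv x (hm'' x (.inl hx))).resolve_left (h1 x hx)
  have h2' : ∀ x ∈ c, A v x := fun x hx => (hSv x (hm'' x (.inr hx))).resolve_right (h2 x hx)
  have hq : (a ++ v :: c).IsChain A := aux_mid hac.1 hcc h1' h2'
  obtain ⟨h3, h4⟩ := aux_split1 (A := A) (v := u) hq (fun x hx => hSu x (hm'' x hx)) hno''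
  have h3' : ∀ x ∈ a, A x u := fun x hx => (hSu x (hm'' x (.inl hx))).resolve_left (h3 x hx)
  have h4' : ∀ x ∈ c, A u x := fun x hx => (hSu x (hm'' x (.inr hx))).resolve_right (h4 x hx)
  have hc_of : ∀ x ∈ S, x ∉ a → x ∈ c := fun x hx hxa => by
    have := (hm' x).2 hx
    rw [List.mem_append] at this
    exact this.resolve_left hxa
  refine ⟨fun x => x ∈ a, fun x _ hx => ⟨h3 x hx, h1 x hx⟩, fun x hx hxa =>
    ⟨h4 x (hc_of x hx hxa), h2 x (hc_of x hx hxa)⟩, ?_⟩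
  intro x _ y hy hxa hya hyx
  have hyc := hc_of y hy hya
  obtain ⟨a1, a2, rfl⟩ := List.append_of_mem hxa
  obtain ⟨c1, c2, rfl⟩ := List.append_of_mem hyc
  have ca := List.isChain_append.1 hac.1
  have cc' : ((c1 ++ [y]) ++ c2).IsChain A := by simpa using hcc
  have cc := List.isChain_append.1 cc'
  have p1 : (a1 ++ u :: (c1 ++ [y])).IsChain A :=
    aux_mid ca.1 cc.1 (fun z hz => h3' z (by simp [hz])) (fun z hz => h4' z (by
      simp only [List.mem_append, List.mem_singleton] at hz
      rcases hz with hz | hz <;> simp [hz]))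
  have p2 : ((x :: a2) ++ v :: c2).IsChain A :=
    aux_mid ca.2.1 cc.2.1 (fun z hz => h1' z (by simp only [List.mem_append]; exact .inr hz))
      (fun z hz => h2' z (by simp [hz]))
  refine hno' ⟨(a1 ++ u :: (c1 ++ [y])) ++ ((x :: a2) ++ v :: c2), ?_, ?_⟩
  · rw [List.isChain_append]
    refine ⟨p1, p2, ?_⟩
    intro z hz w hw
    have : z = y := by
      rw [show a1 ++ u :: (c1 ++ [y]) = (a1 ++ u :: c1) ++ [y] by simp] at hz
      rw [List.getLast?_concat] at hz
      simpa using hz.symm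
    subst this
    simp at hw
    subst hw
    exact hyx
  · classical
    rw [List.perm_iff_count]
    intro z
    simp only [List.count_append, List.count_cons, List.count_nil]
    omega

end PathLemmas

/-- abstract propagation -/
theorem aux_prop (k : ℕ) (hk : 2 ≤ k) (G : ℕ → ℕ → Prop)
    (has : ∀ i j, G i j → ¬ G j i)
    (H1 : ∀ m i, m < 2*k → i ≤ 2*k → (i < m ∧ i % 2 = m % 2 ∨ m + 1 < i ∧ i % 2 = (m+1) % 2) →
      (G i m ∧ G i (m+1)) ∨ (G m i ∧ G (m+1) i))
    (H2 : ∀ m i j, m < 2*k → i < m → i % 2 = m % 2 → m + 1 < j → j ≤ 2*k → j % 2 = (m+1) % 2 →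
      G i m → G m j → G i j)
    (h02 : G 0 2) : ∀ i j, i + 2 ≤ j → j ≤ 2*k → ¬ (i = 0 ∧ j = 2*k) → G i j := by
  have A1 : ∀ i s, 1 ≤ s → i + 2*s + 1 ≤ 2*k → G i (i+2*s) → G i (i+2*s+1) := by
    intro i s hs hi hG
    rcases H1 (i+2*s) i (by omega) (by omega) (by omega) with h | h
    · exact h.2
    · exact absurd h.1 (has _ _ hG)
  have A2 : ∀ i s, 1 ≤ s → i + 2*s + 1 ≤ 2*k → G i (i+2*s+1) → G (i+1) (i+2*s+1) := by
    intro i s hs hi hG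
    rcases H1 i (i+2*s+1) (by omega) (by omega) (by omega) with h | h
    · exact absurd h.1 (has _ _ hG)
    · exact h.2
  have A3 : ∀ s, 1 ≤ s → G 0 (2*s) → ∀ i, i + 2*s ≤ 2*k → G i (i+2*s) := by
    intro s hs h0 i
    induction i with
    | zero => intro _; simpa using h0
    | succ i ih =>
      intro hi
      have := A2 i s hs (by omega) (A1 i s hs (by omega) (ih (by omega)))
      rwa [show i + 1 + 2*s = i + 2*s+1 by omega]
  have A4 : ∀ s, 1 ≤ s → s + 1 ≤ k → G 0 (2*s) := by
    intro s hs
    induction s, hs using Nat.le_induction with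
    | base => intro _; exact h02
    | succ s hs ih =>
      intro hsk
      have g1 := ih (by omega)
      have g2 : G (2*s) (2*s+2*1+1) := A1 _ 1 le_rfl (by omega) (A3 1 le_rfl h02 _ (by omega))
      have g3 := H2 (2*s) 0 (2*s+2*1+1) (by omega) (by omega) (by omega) (by omega) (by omega)
        (by omega) g1 g2
      rcases H1 (2*(s+1)) 0 (by omega) (by omega) (by omega) with h | h
      · exact h.1
      · refine absurd h.2 (has _ _ ?_)
        rwa [show 2*(s+1)+1 = 2*s+2*1+1 by omega]
  intro i j hij hj hne
  have g := A3 ((j-i)/2) (by omega) (A4 _ (by omega) (by omega)) i (by omega)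
  by_cases hp : (j - i) % 2 = 0
  · rwa [show i + 2*((j-i)/2) = j by omega] at g
  · have g' := A1 i _ (by omega) (by omega) g
    rwa [show i + 2*((j-i)/2) + 1 = j by omega] at g'

theorem aux_adj (k : ℕ) (hk : 2 ≤ k) (A : ZMod (2*k+1) → ZMod (2*k+1) → Prop)
    (hso : ∀ u v : ZMod (2*k+1),
      (A u v ∨ A v u) ↔ (u ≠ v ∧ v - u ≠ 1 ∧ u - v ≠ 1)) (u v : ZMod (2*k+1)) :
    (A u v ∨ A v u) ↔ ((u.val + 2 ≤ v.val ∧ ¬ (u.val = 0 ∧ v.val = 2*k)) ∨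
      (v.val + 2 ≤ u.val ∧ ¬ (v.val = 0 ∧ u.val = 2*k))) := by
  have key : ∀ u v : ZMod (2*k+1), v - u = 1 ↔ (v.val = u.val + 1 ∨ (v.val = 0 ∧ u.val = 2*k)) := by
    intro u v
    have hu := ZMod.val_lt u
    have hv := ZMod.val_lt v
    rw [sub_eq_iff_eq_add]
    have : (1 + u).val = (1 + u.val) % (2*k+1) := by
      rw [ZMod.val_add, ZMod.val_one'' (by omega)]
    rw [← (ZMod.val_injective (2*k+1)).eq_iff, this]
    by_cases h : u.val = 2*k
    · rw [h, show 1 + 2*k = 2*k+1 by omega, Nat.mod_self]; omega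
    · rw [Nat.mod_eq_of_lt (by omega)]; omega
  have hu := ZMod.val_lt u
  have hv := ZMod.val_lt v
  rw [hso, Ne, Ne, Ne, key, key, ← (ZMod.val_injective (2*k+1)).eq_iff]
  omega

theorem aux_main (k : ℕ) (hk : 2 ≤ k)
    (A : ZMod (2*k+1) → ZMod (2*k+1) → Prop)
    (hso : ∀ u v : ZMod (2*k+1),
      (A u v ∨ A v u) ↔ (u ≠ v ∧ v - u ≠ 1 ∧ u - v ≠ 1))
    (h : ¬ ∃ P : Set (List (ZMod (2*k+1))), IsPathPartition A P ∧
      OrthogonalPP P {((0 : ℕ) : ZMod (2*k+1)), ((2*k : ℕ) : ZMod (2*k+1))})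
    (m : ℕ) (hm : m < 2*k) :
    ∃ L : ZMod (2*k+1) → Prop, 
      let S : ZMod (2*k+1) → Prop := fun x =>
        (x.val < m ∧ x.val % 2 = m % 2 ∨ m + 1 < x.val ∧ x.val % 2 = (m+1) % 2)
      (∀ x, S x → L x → ¬ A (m : ℕ) x ∧ ¬ A (m + 1 : ℕ) x) ∧
      (∀ x, S x → ¬ L x → ¬ A x (m : ℕ) ∧ ¬ A x (m+1 : ℕ)) ∧
      ∀ x, S x → ∀ y, S y → L x → ¬ L y → ¬ A y x := by
  have adj := aux_adj k hk A hso
  have vl : ∀ x : ZMod (2*k+1), x.val < 2*k+1 := fun x => ZMod.val_lt x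
  have vc : ∀ i, i < 2*k+1 → ((i : ℕ) : ZMod (2*k+1)).val = i := fun i hi => ZMod.val_cast_of_lt hi
  have inj : ∀ x y : ZMod (2*k+1), x = y ↔ x.val = y.val := fun x y =>
    (ZMod.val_injective (2*k+1)).eq_iff.symm
  obtain ⟨p, hpc, hpn, hpm⟩ := aux_ham (A := A) (Finset.univ.filter (fun x : ZMod (2*k+1) =>
      (x.val < m ∧ x.val % 2 ≠ m % 2 ∨ m + 1 < x.val ∧ x.val % 2 = m % 2))) (by
    intro x hx y hy hxy
    simp only [Finset.mem_filter, Finset.mem_univ, true_and] at hx hy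
    rw [Ne, inj] at hxy
    have := vl x
    have := vl y
    rw [adj]
    omega)
  simp only [Finset.mem_filter, Finset.mem_univ, true_and] at hpm
  obtain ⟨L, h1, h2, h3⟩ := aux_split (A := A) (Finset.univ.filter (fun x : ZMod (2*k+1) =>
      (x.val < m ∧ x.val % 2 = m % 2 ∨ m + 1 < x.val ∧ x.val % 2 = (m+1) % 2)))
      (m : ℕ) (m+1 : ℕ) 
      (by simp only [Finset.mem_filter, Finset.mem_univ, true_and, vc m (by omega)]; omega)
      (by simp only [Finset.mem_filter, Finset.mem_univ, true_and, vc (m+1) (by omega)]; omega)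
      (by rw [Ne, inj, vc m (by omega), vc (m+1) (by omega)]; omega)
      (by
        intro x hx y hy hxy
        simp only [Finset.mem_filter, Finset.mem_univ, true_and] at hx hy
        rw [Ne, inj] at hxy
        have := vl x
        have := vl y
        rw [adj]
        omega)
      (by
        intro x hx
        simp only [Finset.mem_filter, Finset.mem_univ, true_and] at hx
        have := vl x
        rw [adj, vc m (by omega)]
        omega)
      (by
        intro x hx
        simp only [Finset.mem_filter, Finset.mem_univ, true_and] at hx
        have := vl x
        rw [adj, vc (m+1) (by omega)]
        omega)
      (by
        rintro ⟨q, hqc, hqn, hqm⟩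
        simp only [Finset.mem_filter, Finset.mem_univ, true_and, inj, vc m (by omega : m < 2*k+1),
          vc (m+1) (by omega : m+1 < 2*k+1)] at hqm
        apply h
        have v0 := vc 0 (by omega)
        have v2 := vc (2*k) (by omega)
        have hdisj : ∀ x, x ∈ p → x ∉ q := by
          intro x hx hx'
          rw [hpm] at hx
          rw [hqm] at hx'
          omega
        have hor : (∀ z : ZMod (2*k+1), z.val = 0 → ∀ w : ZMod (2*k+1), w.val = 2*k → 
            (z ∈ p ∧ w ∉ p ∧ w ∈ q ∧ z ∉ q) ∨ (w ∈ p ∧ z ∉ p ∧ z ∈ q ∧ w ∉ q)) := by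
          intro z hz w hw
          rw [hpm, hpm, hqm, hqm, hz, hw]
          omega
        have hor' := hor _ v0 _ v2
        refine ⟨{p, q}, ⟨?_, ?_, ?_⟩, ?_⟩
        · intro r hr
          rcases hr with rfl | hr
          · refine ⟨?_, hpn, hpc⟩
            rintro rfl
            simp at hor'
            
          · rw [Set.mem_singleton_iff] at hr
            subst hr
            refine ⟨?_, hqn, hqc⟩
            rintro rfl
            simp at hor'
        · intro r hr r' hr' hne x hx hx'
          rw [Set.mem_insert_iff, Set.mem_singleton_iff] at hr hr'
          rcases hr with rfl | rfl <;> rcases hr' with rfl | rfl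
          · exact hne rfl
          · exact hdisj x hx hx'
          · exact hdisj x hx' hx
          · exact hne rfl
        · intro x
          have := vl x
          by_cases hx : x ∈ p
          · exact ⟨p, by simp, hx⟩
          · refine ⟨q, by simp, ?_⟩
            rw [hpm] at hx
            rw [hqm]
            omega
        · intro r hr
          rcases hr with rfl | hr
          · rcases hor' with ho | ho
            · refine ⟨_, ⟨Or.inl rfl, ho.1⟩, ?_⟩
              rintro y ⟨rfl | hy, hyr⟩
              · rfl
              · rw [Set.mem_singleton_iff] at hy; subst hy; exact absurd hyr ho.2.1
            · refine ⟨_, ⟨Or.inr rfl, ho.1⟩, ?_⟩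
              rintro y ⟨rfl | hy, hyr⟩
              · exact absurd hyr ho.2.1
              · exact hy
          · rw [Set.mem_singleton_iff] at hr
            subst hr
            rcases hor' with ho | ho
            · refine ⟨_, ⟨Or.inr rfl, ho.2.2.1⟩, ?_⟩
              rintro y ⟨rfl | hy, hyr⟩
              · exact absurd hyr ho.2.2.2
              · exact hy
            · refine ⟨_, ⟨Or.inl rfl, ho.2.2.1⟩, ?_⟩
              rintro y ⟨rfl | hy, hyr⟩
              · rfl
              · rw [Set.mem_singleton_iff] at hy; subst hy; exact absurd hyr ho.2.2.2)
  simp only [Finset.mem_filter, Finset.mem_univ, true_and] at h1 h2 h3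
  exact ⟨L, h1, h2, h3⟩

/-- if a super-orientation `D` of `(C_{2k+1})ᶜ`, `k ≥ 2`, has no path
partition orthogonal to `{x_0, x_{2k}}`, then `D` is isomorphic to `D⃗_{2k+1}`. -/
theorem stmt_9 (k : ℕ) (hk : 2 ≤ k)
    (A : ZMod (2*k+1) → ZMod (2*k+1) → Prop)
    (hso : ∀ u v : ZMod (2*k+1),
      (A u v ∨ A v u) ↔ (u ≠ v ∧ v - u ≠ 1 ∧ u - v ≠ 1))
    (h : ¬ ∃ P : Set (List (ZMod (2*k+1))), IsPathPartition A P ∧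
      OrthogonalPP P {((0 : ℕ) : ZMod (2*k+1)), ((2*k : ℕ) : ZMod (2*k+1))}) :
    ∃ e : ZMod (2*k+1) ≃ ZMod (2*k+1),
      ∀ u v : ZMod (2*k+1), A u v ↔ DvecArc k (e u) (e v) := by
  have adj := aux_adj k hk A hso
  have main := aux_main k hk A hso h
  have vl : ∀ x : ZMod (2*k+1), x.val < 2*k+1 := fun x => ZMod.val_lt x
  have vc : ∀ i, i < 2*k+1 → ((i : ℕ) : ZMod (2*k+1)).val = i := fun i hi => ZMod.val_cast_of_lt hi
  have cv : ∀ x : ZMod (2*k+1), ((x.val : ℕ) : ZMod (2*k+1)) = x := fun x => ZMod.natCast_zmod_val x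
  let G : ℕ → ℕ → Prop := fun i j =>
    A (i : ZMod (2*k+1)) (j : ZMod (2*k+1)) ∧ ¬ A (j : ZMod (2*k+1)) (i : ZMod (2*k+1))
  have has : ∀ i j, G i j → ¬ G j i := fun i j h1 h2 => h1.2 h2.1
  have adjn : ∀ i j : ℕ, i + 2 ≤ j → j ≤ 2*k → ¬ (i = 0 ∧ j = 2*k) →
      A (i : ZMod (2*k+1)) (j : ZMod (2*k+1)) ∨ A (j : ZMod (2*k+1)) (i : ZMod (2*k+1)) := by
    intro i j h1 h2 h3
    rw [adj, vc i (by omega), vc j (by omega)]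
    exact .inl ⟨h1, h3⟩
  have H1 : ∀ m i, m < 2*k → i ≤ 2*k →
      (i < m ∧ i % 2 = m % 2 ∨ m + 1 < i ∧ i % 2 = (m+1) % 2) →
      (G i m ∧ G i (m+1)) ∨ (G m i ∧ G (m+1) i) := by
    intro m i hm hi hS
    obtain ⟨L, h1, h2, h3⟩ := main m hm
    have e1 : A (i : ZMod (2*k+1)) (m : ZMod (2*k+1)) ∨ A (m : ZMod (2*k+1)) (i : ZMod (2*k+1)) := by
      rcases hS with hS | hS
      · exact adjn _ _ (by omega) (by omega) (by omega)
      · exact (adjn _ _ (by omega) (by omega) (by omega)).symm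
    have e2 : A (i : ZMod (2*k+1)) ((m+1 : ℕ) : ZMod (2*k+1)) ∨
        A ((m+1 : ℕ) : ZMod (2*k+1)) (i : ZMod (2*k+1)) := by
      rcases hS with hS | hS
      · exact adjn _ _ (by omega) (by omega) (by omega)
      · exact (adjn _ _ (by omega) (by omega) (by omega)).symm
    have hS' := hS
    rw [← vc i (by omega)] at hS'
    by_cases hL : L (i : ZMod (2*k+1))
    · have := h1 _ hS' hL
      exact .inl ⟨⟨e1.resolve_right this.1, this.1⟩, ⟨e2.resolve_right this.2, this.2⟩⟩
    · have := h2 _ hS' hL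
      exact .inr ⟨⟨e1.resolve_left this.1, this.1⟩, ⟨e2.resolve_left this.2, this.2⟩⟩
  have H2 : ∀ m i j, m < 2*k → i ≤ 2*k → j ≤ 2*k → (i + 2 ≤ j ∨ j + 2 ≤ i) →
      (i < m ∧ i % 2 = m % 2 ∨ m + 1 < i ∧ i % 2 = (m+1) % 2) →
      (j < m ∧ j % 2 = m % 2 ∨ m + 1 < j ∧ j % 2 = (m+1) % 2) →
      G i m → G m j → G i j := by
    intro m i j hm hi hj hij hSi hSj g1 g2
    obtain ⟨L, h1, h2, h3⟩ := main m hm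
    have e : A (i : ZMod (2*k+1)) (j : ZMod (2*k+1)) ∨ A (j : ZMod (2*k+1)) (i : ZMod (2*k+1)) := by
      rcases hij with hS | hS
      · exact adjn _ _ (by omega) (by omega) (by omega)
      · exact (adjn _ _ (by omega) (by omega) (by omega)).symm
    rw [← vc i (by omega)] at hSi
    rw [← vc j (by omega)] at hSj
    have Li : L (i : ZMod (2*k+1)) := by
      by_contra hL
      exact (h2 _ hSi hL).1 g1.1
    have Lj : ¬ L (j : ZMod (2*k+1)) := by
      intro hL
      exact (h1 _ hSj hL).1 g2.1
    have := h3 _ hSi _ hSj Li Lj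
    exact ⟨e.resolve_right this, this⟩
  have h02 : G 0 2 ∨ G 2 0 := by
    rcases H1 2 0 (by omega) (by omega) (by omega) with h | h
    · exact .inl h.1
    · exact .inr h.1
  rcases h02 with h02 | h02
  · have fw := aux_prop k hk G has H1
      (fun m i j hm hi hi2 hj hjk hj2 g1 g2 => H2 m i j hm (by omega) hjk (by omega)
        (.inl ⟨hi, hi2⟩) (.inr ⟨hj, hj2⟩) g1 g2) h02
    refine ⟨Equiv.refl _, fun u v => ?_⟩
    have hu := vl u
    have hv := vl v
    simp only [Equiv.refl_apply, DvecArc]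
    constructor
    · intro hA
      rcases (adj u v).1 (.inl hA) with h | h
      · exact h
      · have := fw v.val u.val h.1 (by omega) h.2
        simp only [G, cv] at this
        exact absurd hA this.2
    · intro h
      have := fw u.val v.val h.1 (by omega) h.2
      simp only [G, cv] at this
      exact this.1
  · have fw := aux_prop k hk (fun i j => G j i) (fun i j => has j i)
      (fun m i hm hi hS => (H1 m i hm hi hS).symm)
      (fun m i j hm hi hi2 hj hjk hj2 g1 g2 => H2 m j i hm hjk (by omega) (by omega)
        (.inr ⟨hj, hj2⟩) (.inl ⟨hi, hi2⟩) g2 g1) h02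
    have ev : ∀ x : ZMod (2*k+1), (Equiv.subLeft ((2*k : ℕ) : ZMod (2*k+1)) x).val = 2*k - x.val := by
      intro x
      have := vl x
      rw [Equiv.subLeft_apply]
      conv_lhs => rw [← cv x]
      rw [← Nat.cast_sub (by omega), vc _ (by omega)]
    refine ⟨Equiv.subLeft ((2*k : ℕ) : ZMod (2*k+1)), fun u v => ?_⟩
    have hu := vl u
    have hv := vl v
    simp only [DvecArc, ev]
    constructor
    · intro hA
      rcases (adj u v).1 (.inl hA) with h | h
      · have := fw u.val v.val h.1 (by omega) h.2
        simp only [G, cv] at this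
        exact absurd hA this.2
      · omega
    · intro h
      have := fw v.val u.val (by omega) (by omega) (by omega)
      simp only [G, cv] at this
      exact this.1
end

section
/- For every k ≥ 3, the digraph D⃗_{2k+1} contains no induced subdigraph that is an anti-directed odd cycle, yet D⃗_{2k+1} is not α-diperfect. Hence the conjecture of Berge that a digraph is α-diperfect if and only if it contains no induced anti-directed odd cycle is false, and there are infinitely many counterexamples. -/
/-- A directed path of the subdigraph induced by the vertex set `W`. -/
def IsDipathOn {V : Type*} (A : V → V → Prop) (W : Set V) (p : List V) : Prop :=
  p ≠ [] ∧ p.Nodup ∧ (∀ v ∈ p, v ∈ W) ∧ p.Chain' A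

/-- A path partition of the subdigraph induced by the vertex set `W`. -/
def IsPathPartitionOn {V : Type*} (A : V → V → Prop) (W : Set V) (P : Set (List V)) : Prop :=
  (∀ p ∈ P, IsDipathOn A W p) ∧
  (∀ p ∈ P, ∀ q ∈ P, p ≠ q → ∀ v : V, v ∈ p → v ∉ q) ∧
  (∀ v ∈ W, ∃ p ∈ P, v ∈ p)

/-- A stable set: a set of pairwise non-adjacent vertices. -/
def IsStableSet {V : Type*} (A : V → V → Prop) (S : Set V) : Prop :=
  ∀ u ∈ S, ∀ v ∈ S, u ≠ v → ¬ A u v ∧ ¬ A v u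

/-- A digraph is α-diperfect if for every induced subdigraph (on a vertex set `W`) and
every maximum stable set `S` of it, there is a path partition of it orthogonal to `S`. -/
def AlphaDiperfect {V : Type*} (A : V → V → Prop) : Prop :=
  ∀ (W S : Set V), S ⊆ W → IsStableSet A S →
    (∀ T ⊆ W, IsStableSet A T → T.ncard ≤ S.ncard) →
    ∃ P : Set (List V), IsPathPartitionOn A W P ∧ OrthogonalPP P S

/-- The induced subdigraph of `(V, A)` on the vertex set `s` is an anti-directed odd cycle:
its underlying graph is an odd cycle `(y_0, …, y_{2m}, y_0)` with `m ≥ 2`, and each of the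
vertices `y_0, y_1, y_2, y_3, y_5, y_7, …, y_{2m-1}` is a source or a sink in it. -/
def IsAntiDirectedOddCycleOn {V : Type*} (A : V → V → Prop) (s : Set V) : Prop :=
  ∃ m : ℕ, 2 ≤ m ∧ ∃ y : ZMod (2*m+1) → V,
    Function.Injective y ∧ Set.range y = s ∧
    (∀ i j : ZMod (2*m+1),
      (A (y i) (y j) ∨ A (y j) (y i)) ↔ (i ≠ j ∧ (j - i = 1 ∨ i - j = 1))) ∧
    (∀ i : ZMod (2*m+1), (i.val ≤ 3 ∨ Odd i.val) →
      ((∀ j : ZMod (2*m+1), ¬ A (y j) (y i)) ∨ (∀ j : ZMod (2*m+1), ¬ A (y i) (y j))))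

def CycStep (k a b : ℕ) : Prop := b = a + 1 ∨ (a = 2*k ∧ b = 0)

lemma nonadj_step {k : ℕ} {u v : ZMod (2*k+1)} (hne : u ≠ v)
    (h1 : ¬ DvecArc k u v) (h2 : ¬ DvecArc k v u) :
    CycStep k u.val v.val ∨ CycStep k v.val u.val := by
  have h : u.val ≠ v.val := fun h => hne (ZMod.val_injective _ h)
  have hu := ZMod.val_lt u
  have hv := ZMod.val_lt v
  unfold DvecArc at h1 h2
  unfold CycStep
  omega

lemma dipath_gap {k : ℕ} {W : Set (ZMod (2*k+1))} {p : List (ZMod (2*k+1))}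
    (hp : IsDipathOn (DvecArc k) W p) :
    ∀ u ∈ p, ∀ v ∈ p, u ≠ v → u.val + 2 ≤ v.val ∨ v.val + 2 ≤ u.val := by
  have hc : p.IsChain (fun u v : ZMod (2*k+1) => u.val + 2 ≤ v.val) :=
    List.IsChain.imp (fun a b h => h.1) hp.2.2.2
  haveI : IsTrans (ZMod (2*k+1)) (fun u v : ZMod (2*k+1) => u.val + 2 ≤ v.val) :=
    ⟨fun a b c h1 h2 => by omega⟩
  have hpw := hc.pairwise
  have h2 : p.Pairwise (fun u v : ZMod (2*k+1) => u.val + 2 ≤ v.val ∨ v.val + 2 ≤ u.val) :=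
    hpw.imp (fun h => Or.inl h)
  intro u hu v hv hne
  have hs : Std.Symm (fun u v : ZMod (2*k+1) => u.val + 2 ≤ v.val ∨ v.val + 2 ≤ u.val) :=
    ⟨fun _ _ h => Or.symm h⟩
  exact h2.forall hu hv hne

lemma no_five {k a b c d e : ℕ} (hk : 3 ≤ k)
    (ha : a < 2*k+1) (hb : b < 2*k+1) (hc : c < 2*k+1) (hd : d < 2*k+1) (he : e < 2*k+1)
    (hac : a ≠ c) (hbd : b ≠ d) (hce : c ≠ e) (hda : d ≠ a)
    (h1 : CycStep k a b) (h2 : CycStep k b c ∨ CycStep k c b)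
    (h3 : CycStep k c d ∨ CycStep k d c) (h4 : CycStep k d e ∨ CycStep k e d)
    (h5 : CycStep k e a ∨ CycStep k a e) : False := by
  unfold CycStep at *
  have h2' : c = b + 1 ∨ (b = 2*k ∧ c = 0) := by omega
  clear h2
  have h3' : d = c + 1 ∨ (c = 2*k ∧ d = 0) := by omega
  clear h3
  have h4' : e = d + 1 ∨ (d = 2*k ∧ e = 0) := by omega
  clear h4
  have h5' : a = e + 1 ∨ (e = 2*k ∧ a = 0) := by omega
  clear h5
  omega

lemma part_one (k : ℕ) (hk : 3 ≤ k) (s : Set (ZMod (2*k+1))) :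
    ¬ IsAntiDirectedOddCycleOn (DvecArc k) s := by
  rintro ⟨m, hm, y, hinj, -, hadj, -⟩
  have key : ∀ i j : ZMod (2*m+1), i ≠ j → j - i ≠ 1 → i - j ≠ 1 →
      CycStep k (y i).val (y j).val ∨ CycStep k (y j).val (y i).val := by
    intro i j hij h1 h2
    have h := (hadj i j).not.2 (by tauto)
    push Not at h
    exact nonadj_step (fun h => hij (hinj h)) h.1 h.2
  have hne : ∀ i j : ZMod (2*m+1), i ≠ j → (y i).val ≠ (y j).val :=
    fun i j hij h => hij (hinj (ZMod.val_injective _ h))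
  have hlt : ∀ i : ZMod (2*m+1), (y i).val < 2*k+1 := fun i => ZMod.val_lt _
  rcases Nat.lt_or_ge 2 m with h3 | h3
  · have nz : ∀ n : ℕ, 0 < n → n < 2*m+1 → (n : ZMod (2*m+1)) ≠ 0 := by
      intro n h0 hn h
      rw [ZMod.natCast_eq_zero_iff] at h
      exact absurd (Nat.le_of_dvd h0 h) (by omega)
    have n1 := nz 1 (by omega) (by omega)
    have n2 := nz 2 (by omega) (by omega)
    have n3 := nz 3 (by omega) (by omega)
    have n4 := nz 4 (by omega) (by omega)
    have n5 := nz 5 (by omega) (by omega)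
    push_cast at n1 n2 n3 n4 n5
    have k2 := key 0 2 (fun h => n2 (by linear_combination -h))
      (fun h => n1 (by linear_combination h)) (fun h => n3 (by linear_combination -h))
    have k3 := key 0 3 (fun h => n3 (by linear_combination -h))
      (fun h => n2 (by linear_combination h)) (fun h => n4 (by linear_combination -h))
    have k4 := key 0 4 (fun h => n4 (by linear_combination -h))
      (fun h => n3 (by linear_combination h)) (fun h => n5 (by linear_combination -h))
    have d1 := hne 2 3 (fun h => n1 (by linear_combination -h))
    have d2 := hne 3 4 (fun h => n1 (by linear_combination -h))
    have d3 := hne 2 4 (fun h => n2 (by linear_combination -h))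
    have l0 := hlt 0
    have l2 := hlt 2
    have l3 := hlt 3
    have l4 := hlt 4
    unfold CycStep at k2 k3 k4
    omega
  · obtain rfl : m = 2 := by omega
    have a1 := key 0 2 (by decide) (by decide) (by decide)
    have a2 := key 2 4 (by decide) (by decide) (by decide)
    have a3 := key 4 1 (by decide) (by decide) (by decide)
    have a4 := key 1 3 (by decide) (by decide) (by decide)
    have a5 := key 3 0 (by decide) (by decide) (by decide)
    rcases a1 with a1 | a1
    · exact no_five hk (hlt 0) (hlt 2) (hlt 4) (hlt 1) (hlt 3) (hne _ _ (by decide))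
        (hne _ _ (by decide)) (hne _ _ (by decide)) (hne _ _ (by decide)) a1 a2 a3 a4 a5
    · exact no_five hk (hlt 2) (hlt 0) (hlt 3) (hlt 1) (hlt 4) (hne _ _ (by decide))
        (hne _ _ (by decide)) (hne _ _ (by decide)) (hne _ _ (by decide)) a1
        a5.symm a4.symm a3.symm a2.symm

lemma part_two (k : ℕ) (hk : 3 ≤ k) : ¬ AlphaDiperfect (DvecArc k) := by
  intro H
  have cv : ∀ n : ℕ, n < 2*k+1 → ((n : ℕ) : ZMod (2*k+1)).val = n :=
    fun n hn => ZMod.val_cast_of_lt hn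
  have v0 := cv 0 (by omega)
  have vk := cv (2*k) (by omega)
  have hne : ((0 : ℕ) : ZMod (2*k+1)) ≠ ((2*k : ℕ) : ZMod (2*k+1)) := by
    intro h
    rw [h] at v0
    omega
  obtain ⟨P, ⟨hP, hdis, hcov⟩, horth⟩ := H Set.univ
    {((0 : ℕ) : ZMod (2*k+1)), ((2*k : ℕ) : ZMod (2*k+1))} (Set.subset_univ _)
    (by
      intro u hu v hv huv
      simp only [Set.mem_insert_iff, Set.mem_singleton_iff] at hu hv
      unfold DvecArc
      rcases hu with rfl | rfl <;> rcases hv with rfl | rfl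
      · exact absurd rfl huv
      · rw [v0, vk]; omega
      · rw [v0, vk]; omega
      · exact absurd rfl huv)
    (by
      intro T _ hT
      rw [Set.ncard_pair hne]
      by_contra hcon
      rw [not_le, Set.two_lt_ncard_iff (Set.toFinite T)] at hcon
      obtain ⟨a, b, c, ha, hb, hc, hab, hac, hbc⟩ := hcon
      have h1 := nonadj_step hab (hT a ha b hb hab).1 (hT a ha b hb hab).2
      have h2 := nonadj_step hac (hT a ha c hc hac).1 (hT a ha c hc hac).2
      have h3 := nonadj_step hbc (hT b hb c hc hbc).1 (hT b hb c hc hbc).2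
      have e1 : a.val ≠ b.val := fun h => hab (ZMod.val_injective _ h)
      have e2 : a.val ≠ c.val := fun h => hac (ZMod.val_injective _ h)
      have e3 : b.val ≠ c.val := fun h => hbc (ZMod.val_injective _ h)
      have la := ZMod.val_lt a
      have lb := ZMod.val_lt b
      have lc := ZMod.val_lt c
      unfold CycStep at h1 h2 h3
      omega)
  obtain ⟨p, hp, h0p⟩ := hcov ((0 : ℕ) : ZMod (2*k+1)) trivial
  obtain ⟨q, hq, hkq⟩ := hcov ((2*k : ℕ) : ZMod (2*k+1)) trivial
  have hkp : ((2*k : ℕ) : ZMod (2*k+1)) ∉ p := by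
    intro h
    exact hne ((horth p hp).unique ⟨Or.inl rfl, h0p⟩ ⟨Or.inr rfl, h⟩)
  have hall : ∀ v : ZMod (2*k+1), v ∈ p ∨ v ∈ q := by
    intro v
    obtain ⟨r, hr, hvr⟩ := hcov v trivial
    obtain ⟨w, ⟨hwS, hwr⟩, -⟩ := horth r hr
    rcases hwS with rfl | hw
    · by_cases h : r = p
      · exact Or.inl (h ▸ hvr)
      · exact absurd h0p (hdis r hr p hp h _ hwr)
    · rw [Set.mem_singleton_iff] at hw
      subst hw
      by_cases h : r = q
      · exact Or.inr (h ▸ hvr)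
      · exact absurd hkq (hdis r hr q hq h _ hwr)
  have hpq : p ≠ q := by
    rintro rfl
    exact hkp hkq
  have hnq : ∀ v, v ∈ p → v ∉ q := hdis p hp q hq hpq
  have step : ∀ r ∈ P, ∀ n : ℕ, n + 1 < 2*k+1 → ((n : ℕ) : ZMod (2*k+1)) ∈ r →
      ((n + 1 : ℕ) : ZMod (2*k+1)) ∉ r := by
    intro r hr n hn h1 h2
    have c1 := cv n (by omega)
    have c2 := cv (n+1) hn
    have := dipath_gap (hP r hr) _ h1 _ h2 (fun h => by rw [h] at c1; omega)
    rw [c1, c2] at this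
    omega
  have ind : ∀ j : ℕ, 2*j < 2*k+1 → ((2*j : ℕ) : ZMod (2*k+1)) ∈ p := by
    intro j
    induction j with
    | zero => intro _; exact h0p
    | succ j ih =>
      intro hj
      have h1 := ih (by omega)
      have h2 := step p hp (2*j) (by omega) h1
      have h3 := (hall ((2*j+1 : ℕ) : ZMod (2*k+1))).resolve_left h2
      have h4 := step q hq (2*j+1) (by omega) h3
      exact (hall ((2*j+1+1 : ℕ) : ZMod (2*k+1))).resolve_right h4
  exact hkp (ind k (by omega))

/-- for every `k ≥ 3`, `D⃗_{2k+1}` contains no induced anti-directed odd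
cycle, yet it is not α-diperfect; hence Berge's conjecture is false and there are
infinitely many counterexamples. -/
theorem stmt_13 (k : ℕ) (hk : 3 ≤ k) :
    (∀ s : Set (ZMod (2*k+1)), ¬ IsAntiDirectedOddCycleOn (DvecArc k) s) ∧
    ¬ AlphaDiperfect (DvecArc k) := by
  exact ⟨part_one k hk, part_two k hk⟩
end
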